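/- If T is a tree in 𝒯₃ with n vertices and l leaves, then μ(T) < (n − l) + l/2 = n − l/2; consequently, if l ≥ (1 − ε)n for some ε ≥ 0, then D(T) < (1 + ε)/2. -/

import Mathlib

open SimpleGraph Finset BigOperators Filter

attribute [local instance] Classical.propDecidable

/-- A finset of vertices induces a subtree of `G`: it is nonempty and its induced
subgraph is connected. -/
def SimpleGraph.IsSubtree {V : Type*} (G : SimpleGraph V) (s : Finset V) : Prop :=
  s.Nonempty ∧ (G.induce (s : Set V)).Connected

/-- The collection of all subtrees of `G` (as finsets of vertices). -/
noncomputable def subtreeFinset {V : Type*} [Fintype V] (G : SimpleGraph V) :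
    Finset (Finset V) :=
  Finset.univ.filter G.IsSubtree

/-- `μ(G)`: the average order (number of vertices) of a subtree of `G`. -/
noncomputable def mu {V : Type*} [Fintype V] (G : SimpleGraph V) : ℚ :=
  (∑ s ∈ subtreeFinset G, (s.card : ℚ)) / ((subtreeFinset G).card : ℚ)

/-- The number of leaves (vertices of degree one) of `G`. -/
noncomputable def numLeaves {V : Type*} [Fintype V] (G : SimpleGraph V) : ℕ :=
  (Finset.univ.filter (fun v => G.degree v = 1)).card

/-- `G` is in the class 𝒯₃: a tree with at least one internal vertex (a vertex of
degree at least 2) in which every internal vertex has degree at least 3. -/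
noncomputable def InT3 {V : Type*} [Fintype V] (G : SimpleGraph V) : Prop :=
  G.IsTree ∧ (∃ v, 2 ≤ G.degree v) ∧ ∀ v, 2 ≤ G.degree v → 3 ≤ G.degree v

namespace SimpleGraph

variable {V : Type*} {G : SimpleGraph V}

lemma isSubtree_singleton (v : V) : G.IsSubtree {v} := by
  refine ⟨singleton_nonempty v, ?_⟩
  rw [coe_singleton]
  exact ⟨Preconnected.of_subsingleton⟩

/-- Deleting a leaf of the ambient graph from a subtree with another vertex leaves a subtree. -/
lemma IsSubtree.erase_of_degree_eq_one [Fintype V] {s : Finset V} (hs : G.IsSubtree s) {v : V}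
    (hv : v ∈ s) (hdeg : G.degree v = 1) (hne : s ≠ {v}) : G.IsSubtree (s.erase v) := by
  have hnt : s.Nontrivial := (Finset.nontrivial_iff_ne_singleton hv).2 hne
  have : Nontrivial (s : Set V) := Set.nontrivial_coe_sort.2 hnt
  obtain ⟨u, -, hu⟩ := degree_eq_one_iff_existsUnique_adj.1 hdeg
  have hdeg' : (G.induce (s : Set V)).degree ⟨v, hv⟩ = 1 := by
    rw [degree_eq_one_iff_existsUnique_adj]
    obtain ⟨w, hw⟩ := (degree_pos_iff_exists_adj _ _).1
      (hs.2.preconnected.degree_pos_of_nontrivial ⟨v, hv⟩)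
    exact ⟨w, hw, fun x hx => Subtype.ext ((hu x hx).trans (hu w hw).symm)⟩
  refine ⟨hnt.erase_nonempty, ?_⟩
  refine (hs.2.induce_compl_singleton_of_degree_eq_one hdeg').map
    (H := G.induce (s.erase v : Set V))
    ⟨fun x => ⟨x.1.1, ?_⟩, fun h => h⟩ fun x => ?_
  · exact mem_coe.2 (mem_erase.2 ⟨fun h => x.2 (Subtype.ext h), x.1.2⟩)
  · have hx := mem_erase.1 (mem_coe.1 x.2)
    exact ⟨⟨⟨x.1, hx.2⟩, fun h => hx.1 (congrArg Subtype.val h)⟩, rfl⟩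

variable [Fintype V]

lemma mem_subtreeFinset {s : Finset V} : s ∈ subtreeFinset G ↔ G.IsSubtree s := by
  simp [subtreeFinset]

/-- Apart from the one-vertex subtree, at most half of the subtrees contain a given leaf. -/
lemma two_mul_card_subtrees_mem_le {v : V} (hdeg : G.degree v = 1) :
    2 * #{s ∈ subtreeFinset G | v ∈ s} ≤ #(subtreeFinset G) + 1 := by
  have hinj : #({s ∈ subtreeFinset G | v ∈ s}.erase {v}) ≤ #{s ∈ subtreeFinset G | v ∉ s} := by
    refine card_le_card_of_injOn (fun s => s.erase v) (fun s hs => ?_) fun s hs t ht hst => ?_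
    · simp only [coe_erase, Set.mem_sdiff, mem_coe, mem_filter, mem_subtreeFinset,
        Set.mem_singleton_iff] at hs
      simp [mem_subtreeFinset, hs.1.1.erase_of_degree_eq_one hs.1.2 hdeg hs.2]
    · simp only [coe_erase, Set.mem_sdiff, mem_coe, mem_filter] at hs ht
      rw [← insert_erase hs.1.2, ← insert_erase ht.1.2]
      exact congrArg (insert v) hst
  have hmem : {v} ∈ {s ∈ subtreeFinset G | v ∈ s} := by
    simp [mem_subtreeFinset, isSubtree_singleton]
  have hcard := card_erase_add_one hmem
  have hsplit := card_filter_add_card_filter_not (s := subtreeFinset G) (fun s => v ∈ s)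
  omega

/-- The subtrees containing a non-leaf avoid the singletons of the leaves. -/
lemma card_subtrees_mem_add_numLeaves_le {v : V} (hdeg : G.degree v ≠ 1) :
    #{s ∈ subtreeFinset G | v ∈ s} + numLeaves G ≤ #(subtreeFinset G) := by
  have hinj : numLeaves G ≤ #{s ∈ subtreeFinset G | v ∉ s} := by
    refine card_le_card_of_injOn (fun w => {w}) (fun w hw => ?_)
      fun w _ x _ h => singleton_injective h
    have hw : G.degree w = 1 := by simpa using hw
    have hne : v ≠ w := fun h => hdeg (h ▸ hw)
    simp [mem_subtreeFinset, isSubtree_singleton, hne]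
  have hsplit := card_filter_add_card_filter_not (s := subtreeFinset G) (fun s => v ∈ s)
  omega

lemma sum_card_subtrees :
    ∑ s ∈ subtreeFinset G, #s = ∑ v, #{s ∈ subtreeFinset G | v ∈ s} := by
  simpa [bipartiteAbove, bipartiteBelow] using
    (sum_card_bipartiteAbove_eq_sum_card_bipartiteBelow (s := subtreeFinset G)
      (t := (univ : Finset V)) fun s v => v ∈ s)

lemma mu_lt_of_exists_degree (hleaf : ∃ v, G.degree v = 1) (hint : ∃ v, G.degree v ≠ 1) :
    mu G < (Fintype.card V : ℚ) - (numLeaves G : ℚ) / 2 := by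
  obtain ⟨v, hv⟩ := hleaf
  obtain ⟨w, hw⟩ := hint
  have hN : 0 < #(subtreeFinset G) :=
    card_pos.2 ⟨{v}, mem_subtreeFinset.2 (isSubtree_singleton v)⟩
  have hl : 0 < numLeaves G := card_pos.2 ⟨v, by simpa using hv⟩
  have hm : 0 < #{v | G.degree v ≠ 1} := card_pos.2 ⟨w, by simpa using hw⟩
  have hcard : numLeaves G + #{v | G.degree v ≠ 1} = Fintype.card V :=
    card_filter_add_card_filter_not _
  have hleaves : ∑ v with G.degree v = 1, (#{s ∈ subtreeFinset G | v ∈ s} : ℚ) ≤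
      numLeaves G * ((#(subtreeFinset G) + 1) / 2) := by
    rw [numLeaves, ← nsmul_eq_mul]
    refine sum_le_card_nsmul _ _ _ fun x hx => ?_
    have := two_mul_card_subtrees_mem_le (mem_filter.1 hx).2
    have : (2 * #{s ∈ subtreeFinset G | x ∈ s} : ℚ) ≤ #(subtreeFinset G) + 1 := by
      exact_mod_cast this
    linarith
  have hrest : ∑ v with G.degree v ≠ 1, (#{s ∈ subtreeFinset G | v ∈ s} : ℚ) ≤
      #{v | G.degree v ≠ 1} * (#(subtreeFinset G) - numLeaves G : ℚ) := by
    rw [← nsmul_eq_mul]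
    refine sum_le_card_nsmul _ _ _ fun x hx => ?_
    have := card_subtrees_mem_add_numLeaves_le (mem_filter.1 hx).2
    have : (#{s ∈ subtreeFinset G | x ∈ s} : ℚ) + numLeaves G ≤ #(subtreeFinset G) := by
      exact_mod_cast this
    linarith
  have hsum : ∑ s ∈ subtreeFinset G, (#s : ℚ) = ∑ v, (#{s ∈ subtreeFinset G | v ∈ s} : ℚ) := by
    exact_mod_cast sum_card_subtrees
  rw [← sum_filter_add_sum_filter_not univ (fun v => G.degree v = 1)] at hsum
  rw [mu, div_lt_iff₀ (by exact_mod_cast hN), hsum, ← hcard]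
  push_cast
  have hlQ : (1 : ℚ) ≤ numLeaves G := by exact_mod_cast hl
  have hmQ : (1 : ℚ) ≤ #{v | G.degree v ≠ 1} := by exact_mod_cast hm
  nlinarith

end SimpleGraph

/-- If `T ∈ 𝒯₃` has `n` vertices and `l` leaves then `μ(T) < n - l/2`; consequently
if `l ≥ (1 - ε) n` with `ε ≥ 0` then `D(T) < (1 + ε)/2`. -/
theorem mu_lt_n_sub_half_leaves {V : Type*} [Fintype V] (G : SimpleGraph V)
    (h : InT3 G) :
    mu G < (Fintype.card V : ℚ) - (numLeaves G : ℚ) / 2 ∧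
      ∀ ε : ℚ, 0 ≤ ε → (1 - ε) * (Fintype.card V : ℚ) ≤ (numLeaves G : ℚ) →
        mu G / (Fintype.card V : ℚ) < (1 + ε) / 2 := by
  obtain ⟨hT, ⟨w, hw⟩, -⟩ := h
  have : Nontrivial V := by
    obtain ⟨x, hx⟩ := (degree_pos_iff_exists_adj G w).1 (by omega)
    exact ⟨w, x, hx.ne⟩
  have hmu := mu_lt_of_exists_degree hT.exists_vert_degree_one_of_nontrivial ⟨w, by omega⟩
  refine ⟨hmu, fun ε _ hl => ?_⟩
  have hn : (0 : ℚ) < Fintype.card V := by exact_mod_cast Fintype.card_pos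
  rw [div_lt_iff₀ hn]
  linarith
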